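/- arXiv:2512.01344 — 6 statements merged into one kernel-verified Lean document; each statement's English description precedes it below -/
import Mathlib

section
/- The intermediate value satisfies the one-sided estimate b − ρ* ≤ ((−c⁻ + M)/(c⁺ − c⁻))·|a − b|. -/
/-- One-sided estimate on the intermediate value of the central-upwind flux:
`b − ρ* ≤ ((−c⁻ + M)/(c⁺ − c⁻))·|a − b|`. -/
theorem CU_intermediate_upper_estimate
    (ρmin ρmax M : ℝ) (hI : ρmin ≤ ρmax)
    (g g' : ℝ → ℝ) (hg : ∀ x, HasDerivAt g (g' x) x)
    (hM : ∀ x ∈ Set.Icc ρmin ρmax, |g' x| ≤ M)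
    (a b : ℝ) (ha : a ∈ Set.Icc ρmin ρmax) (hb : b ∈ Set.Icc ρmin ρmax)
    (cp cm ρstar : ℝ)
    (hcp : cp = max (max (g' a) (g' b)) 0)
    (hcm : cm = min (min (g' a) (g' b)) 0)
    (hpos : 0 < cp - cm)
    (hρstar : ρstar = (cp * b - cm * a - (g b - g a)) / (cp - cm)) :
    b - ρstar ≤ ((-cm + M) / (cp - cm)) * |a - b| := by
  have hLip : |g b - g a| ≤ M * |b - a| :=
    (convex_Icc ρmin ρmax).norm_image_sub_le_of_norm_hasDerivWithin_le
      (fun x _ => (hg x).hasDerivWithinAt) hM ha hb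
  have hcm_nonpos : cm ≤ 0 := hcm ▸ min_le_right _ _
  have hnum : b - ρstar = (-cm * (b - a) + (g b - g a)) / (cp - cm) := by
    rw [hρstar]
    field_simp
    ring
  rw [hnum, div_mul_eq_mul_div, abs_sub_comm a b, add_mul]
  gcongr
  · exact neg_nonneg.mpr hcm_nonpos
  · exact le_abs_self _
  · exact (le_abs_self _).trans hLip
end

section
/- The built-in anti-diffusion term of the central-upwind flux satisfies d ≤ ((max{c⁺, −c⁻} + M)/(c⁺ − c⁻))·|a − b|. -/
/-- The minmod limiter. -/
noncomputable def minmod (p q : ℝ) : ℝ :=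
  if p * q ≤ 0 then 0 else if |p| < |q| then p else q

theorem minmod_le_abs_left (p q : ℝ) : minmod p q ≤ |p| := by
  unfold minmod
  split_ifs with h₁ h₂
  · exact abs_nonneg p
  · exact le_abs_self p
  · exact (le_abs_self q).trans (not_lt.mp h₂)

/-- Estimate on the built-in anti-diffusion term of the central-upwind flux:
`d ≤ ((max{c⁺, −c⁻} + M)/(c⁺ − c⁻))·|a − b|`. -/
theorem CU_antidiffusion_estimate
    (ρmin ρmax M : ℝ) (hI : ρmin ≤ ρmax)
    (g g' : ℝ → ℝ) (hg : ∀ x, HasDerivAt g (g' x) x)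
    (hM : ∀ x ∈ Set.Icc ρmin ρmax, |g' x| ≤ M)
    (a b : ℝ) (ha : a ∈ Set.Icc ρmin ρmax) (hb : b ∈ Set.Icc ρmin ρmax)
    (cp cm ρstar d : ℝ)
    (hcp : cp = max (max (g' a) (g' b)) 0)
    (hcm : cm = min (min (g' a) (g' b)) 0)
    (hpos : 0 < cp - cm)
    (hρstar : ρstar = (cp * b - cm * a - (g b - g a)) / (cp - cm))
    (hd : d = minmod (b - ρstar) (ρstar - a)) :
    d ≤ ((max cp (-cm) + M) / (cp - cm)) * |a - b| := by
  have hg_lip : |g b - g a| ≤ M * |a - b| := by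
    rw [abs_sub_comm a b]
    exact (convex_Icc ρmin ρmax).norm_image_sub_le_of_norm_hasDerivWithin_le
      (fun x _ => (hg x).hasDerivWithinAt) hM ha hb
  have hcm_nonpos : cm ≤ 0 := hcm ▸ min_le_right _ _
  have hdiff : b - ρstar = (-cm * (b - a) + (g b - g a)) / (cp - cm) := by
    rw [hρstar]
    field_simp
    ring
  calc d ≤ |b - ρstar| := hd ▸ minmod_le_abs_left _ _
    _ = |-cm * (b - a) + (g b - g a)| / (cp - cm) := by
      rw [hdiff, abs_div, abs_of_pos hpos]
    _ ≤ ((max cp (-cm) + M) * |a - b|) / (cp - cm) := by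
      gcongr
      calc |-cm * (b - a) + (g b - g a)|
          ≤ |-cm * (b - a)| + |g b - g a| := abs_add_le _ _
        _ = -cm * |a - b| + |g b - g a| := by
          rw [abs_mul, abs_of_nonneg (neg_nonneg.mpr hcm_nonpos), abs_sub_comm b a]
        _ ≤ max cp (-cm) * |a - b| + M * |a - b| := by
          gcongr
          exact le_max_right _ _
        _ = (max cp (-cm) + M) * |a - b| := by ring
    _ = ((max cp (-cm) + M) / (cp - cm)) * |a - b| := by ring
end

section
/- The central-upwind flux satisfies the Lipschitz-type estimate with respect to its second argument: |G(a, b) − g(b)| ≤ 2M·|a − b|. -/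
/-- Subtracting the minmod of two numbers from their sum does not increase the absolute value. -/
theorem abs_add_sub_minmod_le (p q : ℝ) : |p + q - minmod p q| ≤ |p + q| := by
  unfold minmod
  split_ifs with h h'
  · simp
  · rw [add_sub_cancel_left, ← sq_le_sq]
    nlinarith [sq_nonneg p]
  · rw [add_sub_cancel_right, ← sq_le_sq]
    nlinarith [sq_nonneg q]

/-- Lipschitz-type estimate of the central-upwind flux with respect to its second
argument: `|G(a, b) − g(b)| ≤ 2M·|a − b|`. -/
theorem CU_flux_lipschitz_second
    (ρmin ρmax M : ℝ) (hI : ρmin ≤ ρmax)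
    (g g' : ℝ → ℝ) (hg : ∀ x, HasDerivAt g (g' x) x)
    (hM : ∀ x ∈ Set.Icc ρmin ρmax, |g' x| ≤ M)
    (a b : ℝ) (ha : a ∈ Set.Icc ρmin ρmax) (hb : b ∈ Set.Icc ρmin ρmax)
    (cp cm ρstar d G : ℝ)
    (hcp : cp = max (max (g' a) (g' b)) 0)
    (hcm : cm = min (min (g' a) (g' b)) 0)
    (hpos : 0 < cp - cm)
    (hρstar : ρstar = (cp * b - cm * a - (g b - g a)) / (cp - cm))
    (hd : d = minmod (b - ρstar) (ρstar - a))
    (hG : G = (cp * g a - cm * g b) / (cp - cm) + (cp * cm / (cp - cm)) * (b - a - d)) :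
    |G - g b| ≤ 2 * M * |a - b| := by
  have hΔ : |g b - g a| ≤ M * |b - a| :=
    (convex_Icc ρmin ρmax).norm_image_sub_le_of_norm_hasDerivWithin_le
      (fun x _ => (hg x).hasDerivWithinAt) hM ha hb
  have hMa := abs_le.1 (hM a ha)
  have hMb := abs_le.1 (hM b hb)
  have hM0 : 0 ≤ M := (abs_nonneg _).trans (hM a ha)
  have hcp0 : 0 ≤ cp := hcp ▸ le_max_right _ _
  have hcm0 : cm ≤ 0 := hcm ▸ min_le_right _ _
  have hcmM : |cm| ≤ M := by
    rw [abs_of_nonpos hcm0, neg_le, hcm]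
    exact le_min (le_min hMa.1 hMb.1) (by linarith)
  have hL : |b - a - d| ≤ |b - a| := by
    have h := abs_add_sub_minmod_le (b - ρstar) (ρstar - a)
    rwa [sub_add_sub_cancel, ← hd] at h
  have hGb : G - g b = -(cp / (cp - cm)) * (g b - g a - cm * (b - a - d)) := by
    rw [hG]
    field_simp
    ring
  have hw : |-(cp / (cp - cm))| ≤ 1 := by
    rw [abs_neg, abs_of_nonneg (div_nonneg hcp0 hpos.le), div_le_one hpos]
    linarith
  calc |G - g b| = |-(cp / (cp - cm))| * |g b - g a - cm * (b - a - d)| := by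
        rw [hGb, abs_mul]
    _ ≤ |g b - g a - cm * (b - a - d)| := mul_le_of_le_one_left (abs_nonneg _) hw
    _ ≤ |g b - g a| + |cm| * |b - a - d| := by
        rw [← abs_mul]
        exact abs_sub _ _
    _ ≤ M * |b - a| + M * |b - a| := by gcongr
    _ = 2 * M * |a - b| := by
        rw [abs_sub_comm]
        ring
end

section
/- The central-upwind flux satisfies the Lipschitz-type estimate with respect to its first argument: |G(a, b) − g(a)| ≤ 2M·|a − b|. -/
/-- Lipschitz-type estimate of the central-upwind flux with respect to its first
argument: `|G(a, b) − g(a)| ≤ 2M·|a − b|`. -/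
theorem CU_flux_lipschitz_first
    (ρmin ρmax M : ℝ) (hI : ρmin ≤ ρmax)
    (g g' : ℝ → ℝ) (hg : ∀ x, HasDerivAt g (g' x) x)
    (hM : ∀ x ∈ Set.Icc ρmin ρmax, |g' x| ≤ M)
    (a b : ℝ) (ha : a ∈ Set.Icc ρmin ρmax) (hb : b ∈ Set.Icc ρmin ρmax)
    (cp cm ρstar d G : ℝ)
    (hcp : cp = max (max (g' a) (g' b)) 0)
    (hcm : cm = min (min (g' a) (g' b)) 0)
    (hpos : 0 < cp - cm)
    (hρstar : ρstar = (cp * b - cm * a - (g b - g a)) / (cp - cm))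
    (hd : d = minmod (b - ρstar) (ρstar - a))
    (hG : G = (cp * g a - cm * g b) / (cp - cm) + (cp * cm / (cp - cm)) * (b - a - d)) :
    |G - g a| ≤ 2 * M * |a - b| := by
  have hM0 : 0 ≤ M := (abs_nonneg _).trans (hM a ha)
  obtain ⟨ha1, ha2⟩ := abs_le.mp (hM a ha)
  obtain ⟨hb1, hb2⟩ := abs_le.mp (hM b hb)
  have hcp0 : 0 ≤ cp := hcp ▸ le_max_right _ _
  have hcm0 : cm ≤ 0 := hcm ▸ min_le_right _ _
  have hcpM : cp ≤ M := hcp ▸ max_le (max_le ha2 hb2) hM0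
  have hD : |g b - g a| ≤ M * |b - a| :=
    (convex_Icc ρmin ρmax).norm_image_sub_le_of_norm_hasDerivWithin_le
      (fun x _ => (hg x).hasDerivWithinAt) hM ha hb
  have hE : |b - a - d| ≤ |b - a| := by
    have h := abs_add_sub_minmod_le (b - ρstar) (ρstar - a)
    rwa [← hd, sub_add_sub_cancel] at h
  have hw0 : 0 ≤ -cm / (cp - cm) := div_nonneg (by linarith) hpos.le
  have hw1 : -cm / (cp - cm) ≤ 1 := (div_le_one hpos).mpr (by linarith)
  have hGa : G - g a = -cm / (cp - cm) * ((g b - g a) - cp * (b - a - d)) := by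
    rw [hG]
    field_simp
    ring
  calc |G - g a|
      = -cm / (cp - cm) * |(g b - g a) - cp * (b - a - d)| := by
        rw [hGa, abs_mul, abs_of_nonneg hw0]
    _ ≤ |(g b - g a) - cp * (b - a - d)| := mul_le_of_le_one_left (abs_nonneg _) hw1
    _ ≤ |g b - g a| + cp * |b - a - d| := by
        rw [← abs_of_nonneg hcp0, ← abs_mul, abs_of_nonneg hcp0]
        exact abs_sub _ _
    _ ≤ M * |b - a| + M * |b - a| := by gcongr
    _ = 2 * M * |a - b| := by rw [abs_sub_comm b a]; ring
end

section
/- The central-upwind flux is uniformly bounded: |G(a, b)| ≤ |g(b)| + 2M·|a − b|; in particular, if additionally |g(x)| ≤ Mg for all x ∈ I and 0 ≤ ρmin, then |G(a, b)| ≤ Mg + 2M·ρmax for all a, b ∈ I. -/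
/-- Uniform boundedness of the central-upwind flux: `|G(a, b)| ≤ |g(b)| + 2M·|a − b|`;
in particular, if additionally `|g| ≤ Mg` on `I` and `0 ≤ ρmin`, then
`|G(a, b)| ≤ Mg + 2M·ρmax`. -/
theorem CU_flux_bounded
    (ρmin ρmax M : ℝ) (hI : ρmin ≤ ρmax)
    (g g' : ℝ → ℝ) (hg : ∀ x, HasDerivAt g (g' x) x)
    (hM : ∀ x ∈ Set.Icc ρmin ρmax, |g' x| ≤ M)
    (a b : ℝ) (ha : a ∈ Set.Icc ρmin ρmax) (hb : b ∈ Set.Icc ρmin ρmax)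
    (cp cm ρstar d G : ℝ)
    (hcp : cp = max (max (g' a) (g' b)) 0)
    (hcm : cm = min (min (g' a) (g' b)) 0)
    (hpos : 0 < cp - cm)
    (hρstar : ρstar = (cp * b - cm * a - (g b - g a)) / (cp - cm))
    (hd : d = minmod (b - ρstar) (ρstar - a))
    (hG : G = (cp * g a - cm * g b) / (cp - cm) + (cp * cm / (cp - cm)) * (b - a - d)) :
    |G| ≤ |g b| + 2 * M * |a - b| ∧
      ∀ Mg : ℝ, (∀ x ∈ Set.Icc ρmin ρmax, |g x| ≤ Mg) → 0 ≤ ρmin →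
        |G| ≤ Mg + 2 * M * ρmax := by
  have hMa := abs_le.mp (hM a ha)
  have hMb := abs_le.mp (hM b hb)
  have hM0 : 0 ≤ M := (abs_nonneg _).trans (hM a ha)
  have hp0 : 0 ≤ cp := hcp ▸ le_max_right _ _
  have hn0 : cm ≤ 0 := hcm ▸ min_le_right _ _
  have hpM : cp ≤ M := hcp ▸ max_le (max_le hMa.2 hMb.2) hM0
  have hlip : |g a - g b| ≤ M * |a - b| :=
    (convex_Icc ρmin ρmax).norm_image_sub_le_of_norm_hasDerivWithin_le
      (fun x _ => (hg x).hasDerivWithinAt) hM hb ha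
  have hlim : |b - a - d| ≤ |a - b| := by
    have h := abs_add_sub_minmod_le (b - ρstar) (ρstar - a)
    rwa [← hd, sub_add_sub_cancel, abs_sub_comm b a] at h
  have hw0 : 0 ≤ cp / (cp - cm) := div_nonneg hp0 hpos.le
  have hw1 : cp / (cp - cm) ≤ 1 := (div_le_one hpos).mpr (by linarith)
  have hv0 : 0 ≤ -cm / (cp - cm) := div_nonneg (by linarith) hpos.le
  have hv1 : -cm / (cp - cm) ≤ 1 := (div_le_one hpos).mpr (by linarith)
  have hsplit : G = g b + cp / (cp - cm) * (g a - g b)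
      - cp * (-cm / (cp - cm)) * (b - a - d) := by
    rw [hG]
    field_simp
    ring
  have hfirst : |cp / (cp - cm) * (g a - g b)| ≤ M * |a - b| := by
    rw [abs_mul, abs_of_nonneg hw0]
    exact (mul_le_of_le_one_left (abs_nonneg _) hw1).trans hlip
  have hsecond : |cp * (-cm / (cp - cm)) * (b - a - d)| ≤ M * |a - b| := by
    rw [abs_mul, abs_of_nonneg (mul_nonneg hp0 hv0)]
    exact mul_le_mul ((mul_le_of_le_one_right hp0 hv1).trans hpM) hlim (abs_nonneg _) hM0
  have hbound : |G| ≤ |g b| + 2 * M * |a - b| := by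
    rw [hsplit]
    refine (abs_sub _ _).trans ?_
    linarith [abs_add_le (g b) (cp / (cp - cm) * (g a - g b))]
  refine ⟨hbound, fun Mg hMg h0 => hbound.trans ?_⟩
  have hab : |a - b| ≤ ρmax :=
    abs_le.mpr ⟨by linarith [ha.1, hb.2], by linarith [ha.2, hb.1]⟩
  gcongr
  exact hMg b hb
end

section
/- Discrete maximum principle for the first-order central-upwind scheme (maximum-principle part of Theorem 2.1): if ρ⁰_j ∈ [ρmin, ρmax] for all j ∈ ℤ, then the approximations produced by the scheme satisfy ρⁿ_j ∈ [ρmin, ρmax] for all j ∈ ℤ and all n ∈ ℕ. -/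
open intervalIntegral

theorem exists_minmod_mul_eq {p q : ℝ} (hp : 0 ≤ p) (hq : 0 ≤ q) (t : ℝ) :
    ∃ δ, 0 ≤ δ ∧ δ ≤ p ∧ δ ≤ q ∧ minmod (p * t) (q * t) = δ * t := by
  unfold minmod
  split_ifs with h1 h2
  · exact ⟨0, le_rfl, hp, hq, by ring⟩
  · refine ⟨p, hp, le_rfl, ?_, rfl⟩
    rw [abs_mul, abs_mul, abs_of_nonneg hp, abs_of_nonneg hq] at h2
    exact (lt_of_mul_lt_mul_right h2 (abs_nonneg t)).le
  · refine ⟨q, hq, ?_, le_rfl, rfl⟩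
    have ht : 0 < |t| := abs_pos.mpr (by rintro rfl; simp at h1)
    rw [abs_mul, abs_mul, abs_of_nonneg hp, abs_of_nonneg hq] at h2
    exact le_of_mul_le_mul_right (not_lt.mp h2) ht

/-- Incremental form of the central-upwind flux with anti-diffusion. -/
theorem central_upwind_flux_incremental {a b fa fb cp cm s : ℝ} (hcp : 0 ≤ cp) (hcm : cm ≤ 0)
    (hD : 0 < cp - cm) (hs : fb - fa = s * (b - a)) (hs1 : cm ≤ s) (hs2 : s ≤ cp)
    {r d F : ℝ} (hr : r = (cp * b - cm * a - (fb - fa)) / (cp - cm))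
    (hd : d = minmod (b - r) (r - a))
    (hF : F = (cp * fa - cm * fb) / (cp - cm) + (cp * cm / (cp - cm)) * (b - a - d)) :
    (∃ α, 0 ≤ α ∧ α ≤ -cm ∧ F - fa = -α * (b - a)) ∧
    (∃ β, 0 ≤ β ∧ β ≤ cp ∧ F - fb = -β * (b - a)) := by
  obtain ⟨D, hDdef⟩ : ∃ D, D = cp - cm := ⟨_, rfl⟩
  rw [← hDdef] at hD hr hF
  have hDne : D ≠ 0 := hD.ne'
  have h1 : b - r = (s - cm) / D * (b - a) := by
    rw [hr, hs]; field_simp; rw [hDdef]; ring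
  have h2 : r - a = (cp - s) / D * (b - a) := by
    rw [hr, hs]; field_simp; rw [hDdef]; ring
  obtain ⟨δ, hδ0, hδ1, hδ2, hδ⟩ := exists_minmod_mul_eq
    (div_nonneg (sub_nonneg.mpr hs1) hD.le) (div_nonneg (sub_nonneg.mpr hs2) hD.le) (b - a)
  rw [le_div_iff₀ hD] at hδ1 hδ2
  rw [h1, h2, hδ] at hd
  have hfb : fb = fa + s * (b - a) := by linarith
  have hcpδ : 0 ≤ cp * δ := mul_nonneg hcp hδ0
  have hcmδ : 0 ≤ -cm * δ := mul_nonneg (neg_nonneg.mpr hcm) hδ0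
  have hδ1' : cp * δ + -cm * δ ≤ s - cm := by rw [hDdef] at hδ1; linarith
  have hδ2' : cp * δ + -cm * δ ≤ cp - s := by rw [hDdef] at hδ2; linarith
  refine ⟨⟨-cm * ((cp - s) - cp * δ) / D, ?_, ?_, ?_⟩,
    ⟨cp * ((s - cm) + cm * δ) / D, ?_, ?_, ?_⟩⟩
  · exact div_nonneg (mul_nonneg (by linarith) (by linarith)) hD.le
  · rw [div_le_iff₀ hD]
    exact mul_le_mul_of_nonneg_left (by linarith) (by linarith)
  · rw [hF, hd, hfb]; field_simp; rw [hDdef]; ring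
  · exact div_nonneg (mul_nonneg (by linarith) (by linarith)) hD.le
  · rw [div_le_iff₀ hD]
    exact mul_le_mul_of_nonneg_left (by linarith) (by linarith)
  · rw [hF, hd, hfb]; field_simp; rw [hDdef]; ring

theorem ConvexOn.exists_slope_mem_uIcc {S : Set ℝ} {g g' : ℝ → ℝ} (hc : ConvexOn ℝ S g)
    (hg : ∀ x, HasDerivAt g (g' x) x) {a b : ℝ} (ha : a ∈ S) (hb : b ∈ S) :
    ∃ s ∈ Set.uIcc (g' a) (g' b), g b - g a = s * (b - a) := by
  rcases lt_trichotomy a b with h | rfl | h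
  · have h1 := hc.le_slope_of_hasDerivAt ha hb h (hg a)
    have h2 := hc.slope_le_of_hasDerivAt ha hb h (hg b)
    refine ⟨slope g a b, Set.Icc_subset_uIcc ⟨h1, h2⟩, ?_⟩
    rw [slope_def_field, div_mul_cancel₀ _ (sub_ne_zero.mpr h.ne')]
  · exact ⟨g' a, Set.left_mem_uIcc, by ring⟩
  · have h1 := hc.le_slope_of_hasDerivAt hb ha h (hg b)
    have h2 := hc.slope_le_of_hasDerivAt hb ha h (hg a)
    refine ⟨slope g b a, Set.Icc_subset_uIcc' ⟨h1, h2⟩, ?_⟩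
    have := sub_ne_zero.mpr h.ne'
    rw [slope_def_field]; field_simp; ring

theorem ConcaveOn.exists_slope_mem_uIcc {S : Set ℝ} {g g' : ℝ → ℝ} (hc : ConcaveOn ℝ S g)
    (hg : ∀ x, HasDerivAt g (g' x) x) {a b : ℝ} (ha : a ∈ S) (hb : b ∈ S) :
    ∃ s ∈ Set.uIcc (g' a) (g' b), g b - g a = s * (b - a) := by
  obtain ⟨s, hs, h⟩ := hc.neg.exists_slope_mem_uIcc (g' := fun x => -g' x)
    (fun x => (hg x).neg) ha hb
  refine ⟨-s, ?_, by simp only [Pi.neg_apply] at h; linarith⟩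
  rw [Set.mem_uIcc] at hs ⊢
  rcases hs with hs | hs
  · exact Or.inr ⟨by linarith, by linarith⟩
  · exact Or.inl ⟨by linarith, by linarith⟩

/-- Summation by parts against nonnegative nonincreasing weights. -/
theorem sum_mul_sub_succ_le {γ u : ℕ → ℝ} (hu : ∀ k, 0 ≤ u k) (m : ℕ)
    (hγ : ∀ k < m, γ (k + 1) ≤ γ k) :
    ∑ k ∈ Finset.range (m + 1), γ k * (u k - u (k + 1)) + γ m * u (m + 1) ≤ γ 0 * u 0 := by
  induction m with
  | zero => simp; linarith
  | succ m ih =>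
    have h1 := ih fun k hk => hγ k (by omega)
    have h2 := mul_le_mul_of_nonneg_right (hγ m (by omega)) (hu (m + 1))
    rw [Finset.sum_range_succ]
    linarith

theorem sum_mul_mem_Icc {γ r : ℕ → ℝ} {m M : ℝ} {N : ℕ} (hγ0 : ∀ k < N, 0 ≤ γ k)
    (hγ1 : ∑ k ∈ Finset.range N, γ k = 1) (hr : ∀ k, r k ∈ Set.Icc m M) :
    ∑ k ∈ Finset.range N, γ k * r k ∈ Set.Icc m M := by
  constructor
  · calc m = ∑ k ∈ Finset.range N, γ k * m := by rw [← Finset.sum_mul, hγ1, one_mul]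
      _ ≤ _ := Finset.sum_le_sum fun k hk =>
        mul_le_mul_of_nonneg_left (hr k).1 (hγ0 k (Finset.mem_range.mp hk))
  · calc _ ≤ ∑ k ∈ Finset.range N, γ k * M := Finset.sum_le_sum fun k hk =>
        mul_le_mul_of_nonneg_left (hr k).2 (hγ0 k (Finset.mem_range.mp hk))
      _ = M := by rw [← Finset.sum_mul, hγ1, one_mul]

/-- One-cell shift of a weighted average with nonincreasing weights. -/
theorem sum_shift_sub_mem_Icc {γ r : ℕ → ℝ} {m M : ℝ} {N : ℕ} (hN : 1 ≤ N)
    (hγ0 : ∀ k < N, 0 ≤ γ k) (hγ : ∀ k, k + 1 < N → γ (k + 1) ≤ γ k)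
    (hr : ∀ k, r k ∈ Set.Icc m M) :
    ∑ k ∈ Finset.range N, γ k * r (k + 1) - ∑ k ∈ Finset.range N, γ k * r k
      ∈ Set.Icc (-(γ 0 * (r 0 - m))) (γ 0 * (M - r 0)) := by
  obtain ⟨l, rfl⟩ : ∃ l, N = l + 1 := ⟨N - 1, by omega⟩
  have hl : 0 ≤ γ l := hγ0 l (by omega)
  rw [← Finset.sum_sub_distrib]
  constructor
  · have h := sum_mul_sub_succ_le (u := fun k => r k - m) (fun k => sub_nonneg.mpr (hr k).1) l
      fun k hk => hγ k (by omega)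
    have h2 := mul_nonneg hl (sub_nonneg.mpr (hr (l + 1)).1)
    have h3 : ∑ k ∈ Finset.range (l + 1), γ k * ((r k - m) - (r (k + 1) - m))
        = -∑ k ∈ Finset.range (l + 1), (γ k * r (k + 1) - γ k * r k) := by
      rw [← Finset.sum_neg_distrib]
      exact Finset.sum_congr rfl fun k _ => by ring
    linarith
  · have h := sum_mul_sub_succ_le (u := fun k => M - r k) (fun k => sub_nonneg.mpr (hr k).2) l
      fun k hk => hγ k (by omega)
    have h2 := mul_nonneg hl (sub_nonneg.mpr (hr (l + 1)).2)
    have h3 : ∑ k ∈ Finset.range (l + 1), γ k * ((M - r k) - (M - r (k + 1)))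
        = ∑ k ∈ Finset.range (l + 1), (γ k * r (k + 1) - γ k * r k) :=
      Finset.sum_congr rfl fun k _ => by ring
    linarith

/-- Cell averages of a nonnegative nonincreasing kernel of mass one. -/
theorem kernel_cell_integrals {η Δx : ℝ} {ω : ℝ → ℝ} {N : ℕ} {γ : ℕ → ℝ} (hω : Continuous ω)
    (hωpos : ∀ x ∈ Set.Icc 0 η, 0 ≤ ω x)
    (hωdec : ∀ x ∈ Set.Icc 0 η, ∀ y ∈ Set.Icc 0 η, x ≤ y → ω y ≤ ω x)
    (hωint : (∫ x in (0:ℝ)..η, ω x) = 1) (hΔx : 0 < Δx) (hgrid : η = N * Δx)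
    (hγ : ∀ k : ℕ, γ k = ∫ x in (k * Δx)..((k + 1) * Δx), ω x) :
    (∀ k < N, 0 ≤ γ k) ∧ (∀ k, k + 1 < N → γ (k + 1) ≤ γ k) ∧
      ∑ k ∈ Finset.range N, γ k = 1 := by
  have hshift : ∀ k : ℕ, γ k = ∫ x in (0:ℝ)..Δx, ω (x + k * Δx) := fun k => by
    rw [hγ, intervalIntegral.integral_comp_add_right]
    congr 1 <;> ring
  have hmem : ∀ k < N, ∀ x ∈ Set.Icc 0 Δx, x + k * Δx ∈ Set.Icc 0 η := fun k hk x hx => by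
    have h1 : (k : ℝ) + 1 ≤ N := by exact_mod_cast hk
    have h2 := mul_le_mul_of_nonneg_right h1 hΔx.le
    have h3 : 0 ≤ (k : ℝ) * Δx := by positivity
    exact ⟨by linarith [hx.1], by rw [hgrid]; linarith [hx.2]⟩
  refine ⟨fun k hk => ?_, fun k hk => ?_, ?_⟩
  · rw [hshift]
    exact intervalIntegral.integral_nonneg hΔx.le fun x hx => hωpos _ (hmem k hk x hx)
  · rw [hshift, hshift]
    refine intervalIntegral.integral_mono_on hΔx.le
      (Continuous.intervalIntegrable (by fun_prop) _ _)
      (Continuous.intervalIntegrable (by fun_prop) _ _) fun x hx => ?_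
    refine hωdec _ (hmem k (by omega) x hx) _ (hmem (k + 1) hk x hx) ?_
    push_cast
    linarith
  · have h := intervalIntegral.sum_integral_adjacent_intervals (f := ω)
      (μ := MeasureTheory.volume) (a := fun k : ℕ => (k : ℝ) * Δx) (n := N)
      fun k _ => hω.intervalIntegrable _ _
    simp only [Nat.cast_zero, zero_mul, ← hgrid, hωint] at h
    rw [← h]
    exact Finset.sum_congr rfl fun k _ => by rw [hγ]; push_cast; rfl

theorem exists_sub_eq_mul_sub_of_mem_Icc {v v' : ℝ → ℝ} (hv : ∀ x, HasDerivAt v (v' x) x)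
    {m M x y : ℝ} (hx : x ∈ Set.Icc m M) (hy : y ∈ Set.Icc m M) :
    ∃ ξ ∈ Set.Icc m M, v y - v x = v' ξ * (y - x) := by
  have hcont : Continuous v := continuous_iff_continuousAt.mpr fun x => (hv x).continuousAt
  rcases lt_trichotomy x y with h | rfl | h
  · obtain ⟨ξ, hξ, e⟩ := exists_hasDerivAt_eq_slope v v' h hcont.continuousOn fun x _ => hv x
    refine ⟨ξ, ⟨hx.1.trans hξ.1.le, hξ.2.le.trans hy.2⟩, ?_⟩
    rw [e, div_mul_cancel₀ _ (sub_ne_zero.mpr h.ne')]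
  · exact ⟨x, hx, by ring⟩
  · obtain ⟨ξ, hξ, e⟩ := exists_hasDerivAt_eq_slope v v' h hcont.continuousOn fun x _ => hv x
    refine ⟨ξ, ⟨hy.1.trans hξ.1.le, hξ.2.le.trans hx.2⟩, ?_⟩
    have := sub_ne_zero.mpr h.ne'
    rw [e]; field_simp; ring

/-- An incremental update with nonnegative coefficients and a controlled source stays in the
interval. -/
theorem incremental_update_mem_Icc {m M a b c α β G K l γ₀ ν q : ℝ}
    (ha : a ∈ Set.Icc m M) (hb : b ∈ Set.Icc m M) (hc : c ∈ Set.Icc m M)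
    (hl : 0 ≤ l) (hα : 0 ≤ α) (hβ : 0 ≤ β) (hG : 0 ≤ G) (hν : ν ≤ 0) (hνK : -K ≤ ν)
    (hγ₀ : 0 ≤ γ₀) (hq : q ∈ Set.Icc (-(γ₀ * (b - m))) (γ₀ * (M - b)))
    (hcfl : l * (α + β + G * K * γ₀) ≤ 1) :
    b + l * (α * (c - b) + β * (a - b) - ν * q * G) ∈ Set.Icc m M := by
  have key : ∀ u x y z : ℝ, 0 ≤ u → x ≤ u → y ≤ u → z ≤ γ₀ * u →
      l * (α * x + β * y + -ν * z * G) ≤ u := fun u x y z hu hx hy hz => by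
    have h1 := mul_le_mul_of_nonneg_left hx hα
    have h2 := mul_le_mul_of_nonneg_left hy hβ
    have h3 : -ν * z ≤ K * (γ₀ * u) :=
      (mul_le_mul_of_nonneg_left hz (by linarith)).trans
        (mul_le_mul_of_nonneg_right (by linarith) (by positivity))
    have h4 := mul_le_mul_of_nonneg_right h3 hG
    calc l * (α * x + β * y + -ν * z * G)
        ≤ l * (α * u + β * u + K * (γ₀ * u) * G) :=
          mul_le_mul_of_nonneg_left (by linarith) hl
      _ = l * (α + β + G * K * γ₀) * u := by ring
      _ ≤ 1 * u := mul_le_mul_of_nonneg_right hcfl hu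
      _ = u := one_mul u
  constructor
  · have := key (b - m) (b - c) (b - a) (-q) (by linarith [hb.1]) (by linarith [hc.1])
      (by linarith [ha.1]) (by linarith [hq.1])
    linarith
  · have := key (M - b) (c - b) (a - b) q (by linarith [hb.2]) (by linarith [hc.2])
      (by linarith [ha.2]) hq.2
    linarith

/-- Discrete maximum principle for the first-order central-upwind scheme for the
nonlocal conservation law `ρ_t + (g(ρ)v(ω∗ρ))_x = 0`: under the CFL condition
`λ·((2‖g'‖ρmax + ‖g‖)‖v'‖γ₀ + 4‖g'‖‖v‖) ≤ 1`, if `ρ⁰_j ∈ [ρmin, ρmax]` for all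
`j ∈ ℤ`, then `ρⁿ_j ∈ [ρmin, ρmax]` for all `j ∈ ℤ` and all `n ∈ ℕ`. -/
theorem CU_scheme_maximum_principle
    (ρmin ρmax : ℝ) (hρmin : 0 ≤ ρmin) (hI : ρmin ≤ ρmax)
    -- the flux functions g and v, continuously differentiable
    (g g' : ℝ → ℝ) (hg : ∀ x, HasDerivAt g (g' x) x) (hg' : Continuous g')
    (v v' : ℝ → ℝ) (hv : ∀ x, HasDerivAt v (v' x) x) (hv' : Continuous v')
    (hgpos : ∀ x ∈ Set.Icc ρmin ρmax, 0 ≤ g x)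
    (hgconv : ConvexOn ℝ (Set.Icc ρmin ρmax) g ∨ ConcaveOn ℝ (Set.Icc ρmin ρmax) g)
    (hvpos : ∀ x ∈ Set.Icc ρmin ρmax, 0 ≤ v x)
    (hvdec : ∀ x ∈ Set.Icc ρmin ρmax, v' x ≤ 0)
    -- bounds playing the role of the suprema ‖g‖, ‖g'‖, ‖v‖, ‖v'‖ over I
    (Mg Mg' Mv Mv' : ℝ)
    (hMg : ∀ x ∈ Set.Icc ρmin ρmax, |g x| ≤ Mg)
    (hMg' : ∀ x ∈ Set.Icc ρmin ρmax, |g' x| ≤ Mg')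
    (hMv : ∀ x ∈ Set.Icc ρmin ρmax, |v x| ≤ Mv)
    (hMv' : ∀ x ∈ Set.Icc ρmin ρmax, |v' x| ≤ Mv')
    -- the kernel ω with compact support [0, η]
    (η : ℝ) (hη : 0 < η) (ω : ℝ → ℝ) (hωC1 : ContDiff ℝ 1 ω)
    (hωpos : ∀ x ∈ Set.Icc 0 η, 0 ≤ ω x)
    (hωdec : ∀ x ∈ Set.Icc 0 η, ∀ y ∈ Set.Icc 0 η, x ≤ y → ω y ≤ ω x)
    (hωint : (∫ x in (0:ℝ)..η, ω x) = 1)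
    -- the grid
    (Δx Δt : ℝ) (hΔx : 0 < Δx) (hΔt : 0 < Δt)
    (Nη : ℕ) (hNη : 1 ≤ Nη) (hgrid : η = Nη * Δx)
    (γ : ℕ → ℝ) (hγ : ∀ k, γ k = ∫ x in (k * Δx)..((k + 1) * Δx), ω x)
    -- the scheme: nonlocal term, speeds, intermediate value, anti-diffusion, flux,
    -- explicit Euler update
    (ρ : ℕ → ℤ → ℝ) (R cp cm ρstar d F : ℕ → ℤ → ℝ)
    (hR : ∀ n j, R n j = ∑ k ∈ Finset.range Nη, γ k * ρ n (j + k + 1))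
    (hcp : ∀ n j, cp n j
      = max (max (g' (ρ n j) * v (R n j)) (g' (ρ n (j + 1)) * v (R n j))) 0)
    (hcm : ∀ n j, cm n j
      = min (min (g' (ρ n j) * v (R n j)) (g' (ρ n (j + 1)) * v (R n j))) 0)
    (hpos : ∀ n j, 0 < cp n j - cm n j)
    (hρstar : ∀ n j, ρstar n j
      = (cp n j * ρ n (j + 1) - cm n j * ρ n j
          - (g (ρ n (j + 1)) - g (ρ n j)) * v (R n j)) / (cp n j - cm n j))
    (hd : ∀ n j, d n j = minmod (ρ n (j + 1) - ρstar n j) (ρstar n j - ρ n j))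
    (hF : ∀ n j, F n j
      = (cp n j * (g (ρ n j) * v (R n j)) - cm n j * (g (ρ n (j + 1)) * v (R n j)))
          / (cp n j - cm n j)
        + (cp n j * cm n j / (cp n j - cm n j)) * (ρ n (j + 1) - ρ n j - d n j))
    (hupdate : ∀ n j, ρ (n + 1) j = ρ n j - (Δt / Δx) * (F n j - F n (j - 1)))
    -- the CFL condition
    (hCFL : (Δt / Δx) * ((2 * Mg' * ρmax + Mg) * Mv' * γ 0 + 4 * Mg' * Mv) ≤ 1)
    -- initial data in I
    (h0 : ∀ j, ρ 0 j ∈ Set.Icc ρmin ρmax) :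
    ∀ n j, ρ n j ∈ Set.Icc ρmin ρmax := by
  obtain ⟨hγ0, hγdec, hγsum⟩ :=
    kernel_cell_integrals hωC1.continuous hωpos hωdec hωint hΔx hgrid hγ
  have hl : 0 ≤ Δt / Δx := (div_pos hΔt hΔx).le
  have hminI : ρmin ∈ Set.Icc ρmin ρmax := ⟨le_rfl, hI⟩
  have hMg0 : 0 ≤ Mg' := (abs_nonneg _).trans (hMg' _ hminI)
  have hMv0 : 0 ≤ Mv := (abs_nonneg _).trans (hMv _ hminI)
  have hMv0' : 0 ≤ Mv' := (abs_nonneg _).trans (hMv' _ hminI)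
  have hγ00 : 0 ≤ γ 0 := hγ0 0 hNη
  intro n
  induction n with
  | zero => exact h0
  | succ n ih =>
    have hRmem : ∀ j, R n j ∈ Set.Icc ρmin ρmax := fun j => by
      rw [hR]
      exact sum_mul_mem_Icc (r := fun k => ρ n (j + k + 1)) hγ0 hγsum fun k => ih _
    have hspeed : ∀ i j, |g' (ρ n i) * v (R n j)| ≤ Mg' * Mv := fun i j => by
      rw [abs_mul]
      exact mul_le_mul (hMg' _ (ih i)) (hMv _ (hRmem j)) (abs_nonneg _) hMg0
    have hMM : 0 ≤ Mg' * Mv := mul_nonneg hMg0 hMv0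
    have hcp_le : ∀ j, cp n j ≤ Mg' * Mv := fun j => by
      rw [hcp]
      exact max_le (max_le (abs_le.mp (hspeed _ _)).2 (abs_le.mp (hspeed _ _)).2) hMM
    have hcm_le : ∀ j, -cm n j ≤ Mg' * Mv := fun j => by
      rw [hcm, neg_le]
      exact le_min (le_min (abs_le.mp (hspeed _ _)).1 (abs_le.mp (hspeed _ _)).1) (by linarith)
    have hflux : ∀ j,
        (∃ α, 0 ≤ α ∧ α ≤ -cm n j ∧
          F n j - g (ρ n j) * v (R n j) = -α * (ρ n (j + 1) - ρ n j)) ∧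
        (∃ β, 0 ≤ β ∧ β ≤ cp n j ∧
          F n j - g (ρ n (j + 1)) * v (R n j) = -β * (ρ n (j + 1) - ρ n j)) := fun j => by
      obtain ⟨s, hs, hsg⟩ : ∃ s ∈ Set.uIcc (g' (ρ n j)) (g' (ρ n (j + 1))),
          g (ρ n (j + 1)) - g (ρ n j) = s * (ρ n (j + 1) - ρ n j) :=
        hgconv.elim (fun h => h.exists_slope_mem_uIcc hg (ih j) (ih (j + 1)))
          fun h => h.exists_slope_mem_uIcc hg (ih j) (ih (j + 1))
      have hV := hvpos _ (hRmem j)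
      have hsV : cm n j ≤ s * v (R n j) ∧ s * v (R n j) ≤ cp n j := by
        rw [hcm, hcp]
        rcases Set.mem_uIcc.mp hs with h | h
        · have h1 := mul_le_mul_of_nonneg_right h.1 hV
          have h2 := mul_le_mul_of_nonneg_right h.2 hV
          exact ⟨((min_le_left _ _).trans (min_le_left _ _)).trans h1,
            h2.trans ((le_max_right _ _).trans (le_max_left _ _))⟩
        · have h1 := mul_le_mul_of_nonneg_right h.1 hV
          have h2 := mul_le_mul_of_nonneg_right h.2 hV
          exact ⟨((min_le_left _ _).trans (min_le_right _ _)).trans h1,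
            h2.trans ((le_max_left _ _).trans (le_max_left _ _))⟩
      exact central_upwind_flux_incremental (s := s * v (R n j))
        (by rw [hcp]; exact le_max_right _ _) (by rw [hcm]; exact min_le_right _ _) (hpos n j)
        (by rw [← sub_mul, hsg]; ring) hsV.1 hsV.2
        (r := ρstar n j) (by rw [hρstar, sub_mul]) (hd n j) (hF n j)
    intro j
    obtain ⟨α, hα0, hα1, hα⟩ := (hflux j).1
    obtain ⟨β, hβ0, hβ1, hβ⟩ := (hflux (j - 1)).2
    rw [sub_add_cancel] at hβ
    have hq : R n j - R n (j - 1) ∈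
        Set.Icc (-(γ 0 * (ρ n j - ρmin))) (γ 0 * (ρmax - ρ n j)) := by
      have h := sum_shift_sub_mem_Icc (r := fun k => ρ n (j + k)) hNη hγ0 hγdec fun k => ih _
      have e1 : R n j = ∑ k ∈ Finset.range Nη, γ k * ρ n (j + ((k + 1 : ℕ) : ℤ)) := by
        rw [hR]
        exact Finset.sum_congr rfl fun k _ => by push_cast; rw [add_assoc]
      have e2 : R n (j - 1) = ∑ k ∈ Finset.range Nη, γ k * ρ n (j + (k : ℤ)) := by
        rw [hR]
        exact Finset.sum_congr rfl fun k _ => by congr 2; ring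
      rw [e1, e2]
      simpa using h
    obtain ⟨ξ, hξ, hvξ⟩ := exists_sub_eq_mul_sub_of_mem_Icc hv (hRmem (j - 1)) (hRmem j)
    have hG0 := hgpos _ (ih j)
    have hGle : g (ρ n j) ≤ Mg := (le_abs_self _).trans (hMg _ (ih j))
    have hcfl : (Δt / Δx) * (α + β + g (ρ n j) * Mv' * γ 0) ≤ 1 := by
      refine (mul_le_mul_of_nonneg_left ?_ hl).trans hCFL
      have h1 : g (ρ n j) * Mv' * γ 0 ≤ (2 * Mg' * ρmax + Mg) * Mv' * γ 0 := by
        have : 0 ≤ 2 * Mg' * ρmax := mul_nonneg (by linarith) (hρmin.trans hI)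
        gcongr
        linarith
      linarith [hcp_le (j - 1), hcm_le j]
    have := incremental_update_mem_Icc (ih (j - 1)) (ih j) (ih (j + 1)) hl hα0 hβ0 hG0
      (hvdec _ hξ) (abs_le.mp (hMv' _ hξ)).1 hγ00 hq hcfl
    convert this using 1
    rw [hupdate, ← hvξ]
    linear_combination (-(Δt / Δx)) * hα + (Δt / Δx) * hβ
end
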